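/- For every f ∈ Hom_k(Λ^m W, Λ^n W), the first-order polydifferential operator F₁(f) satisfies d₁(F₁(f)) = 0 and d₂(F₁(f)) = 0; that is, F₁ maps Hom_k(Λ^m W, Λ^n W) into d_gs-cocycles of the polydifferential Gerstenhaber–Schack complex of B. (The claim 'd_gs ∘ F₁ = 0' in the proof of Theorem 1.2 of the paper.) -/

import Mathlib

noncomputable section

open MvPolynomial

namespace GS

variable (k : Type) [Field k] [CharZero k] (N : ℕ)

/-- Model of `B^{⊗n}` where `B = k[x¹,…,x^N]`: polynomials in `n` groups ("slots")
of `N` variables; the slot-`t` variables model the `t`-th tensor factor. -/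
abbrev Pn (n : ℕ) : Type := MvPolynomial (Fin n × Fin N) k

/-- The iterated comultiplication `Δ^{n-1} : B → B^{⊗n}`, the algebra map `x_i ↦ Σ_t x_{(t,i)}`. -/
def Δiter (n : ℕ) : MvPolynomial (Fin N) k →ₐ[k] Pn k N n :=
  MvPolynomial.aeval fun i => ∑ t : Fin n, MvPolynomial.X (t, i)

/-- The algebra map `B^{⊗m} → B^{⊗n}` applying `Δ^{n-1}` to every tensor factor and
multiplying the results in `B^{⊗n}`. -/
def spread (m n : ℕ) : Pn k N m →ₐ[k] Pn k N n :=
  MvPolynomial.aeval fun p => ∑ t : Fin n, MvPolynomial.X (t, p.2)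

/-- The operator `∂^{I_1} ⊗ ⋯ ⊗ ∂^{I_m}` on `B^{⊗m}`. -/
def derivOp (m : ℕ) (Is : Fin m → List (Fin N)) : Pn k N m →ₗ[k] Pn k N m :=
  ((List.finRange m).flatMap fun s => (Is s).map fun i => ((s, i) : Fin m × Fin N)).foldr
    (fun p g => (MvPolynomial.pderiv p).toLinearMap.comp g) LinearMap.id

/-- The prefactor `x^{J_1} ⊗ ⋯ ⊗ x^{J_n} ∈ B^{⊗n}`. -/
def xMon (n : ℕ) (Js : Fin n → List (Fin N)) : Pn k N n :=
  ∏ t : Fin n, ((Js t).map fun i => (MvPolynomial.X (t, i) : Pn k N n)).prod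

/-- The basic polydifferential operator `Γ^{J_1…J_n}_{I_1…I_m} : B^{⊗m} → B^{⊗n}`,
`f₁⊗…⊗f_m ↦ (x^{J_1}⊗…⊗x^{J_n}) ⋅ Δ^{n-1}(∂^{I_1}f_1) ⋯ Δ^{n-1}(∂^{I_m}f_m)`. -/
def Γop (m n : ℕ) (Is : Fin m → List (Fin N)) (Js : Fin n → List (Fin N)) :
    Pn k N m →ₗ[k] Pn k N n :=
  (LinearMap.mulLeft k (xMon k N n Js)) ∘ₗ (spread k N m n).toLinearMap ∘ₗ derivOp k N m Is

/-- `Hom_poly(B^{⊗m}, B^{⊗n})`: the linear span of the basic polydifferential operators. -/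
def polyHom (m n : ℕ) : Submodule k (Pn k N m →ₗ[k] Pn k N n) :=
  Submodule.span k {g | ∃ Is Js, g = Γop k N m n Is Js}

/-- Exponents of the slot-0 part of a monomial of `B^{⊗(m+1)}`. -/
def frontExp (m : ℕ) (μ : (Fin (m + 1) × Fin N) →₀ ℕ) : Fin N →₀ ℕ :=
  Finsupp.comapDomain (fun i => ((0 : Fin (m + 1)), i)) μ
    (fun a _ b _ h => by simpa using h)

/-- Exponents of the slots `1,…,m` part of a monomial of `B^{⊗(m+1)}`. -/
def restExp (m : ℕ) (μ : (Fin (m + 1) × Fin N) →₀ ℕ) : (Fin m × Fin N) →₀ ℕ :=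
  Finsupp.comapDomain (fun p : Fin m × Fin N => (p.1.succ, p.2)) μ
    (fun a _ b _ h => by
      rcases a with ⟨a1, a2⟩; rcases b with ⟨b1, b2⟩
      simp only [Prod.mk.injEq] at h ⊢
      exact ⟨Fin.succ_inj.mp h.1, h.2⟩)

/-- Exponents of the last-slot part of a monomial of `B^{⊗(m+1)}`. -/
def lastExp (m : ℕ) (μ : (Fin (m + 1) × Fin N) →₀ ℕ) : Fin N →₀ ℕ :=
  Finsupp.comapDomain (fun i => ((Fin.last m : Fin (m + 1)), i)) μ
    (fun a _ b _ h => by simpa using h)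

/-- Exponents of the slots `0,…,m-1` part of a monomial of `B^{⊗(m+1)}`. -/
def initExp (m : ℕ) (μ : (Fin (m + 1) × Fin N) →₀ ℕ) : (Fin m × Fin N) →₀ ℕ :=
  Finsupp.comapDomain (fun p : Fin m × Fin N => (p.1.castSucc, p.2)) μ
    (fun a _ b _ h => by
      rcases a with ⟨a1, a2⟩; rcases b with ⟨b1, b2⟩
      simp only [Prod.mk.injEq] at h ⊢
      exact ⟨Fin.castSucc_inj.mp h.1, h.2⟩)

/-- The term `v₀ ⊗ v₁ ⊗ … ⊗ v_m ↦ Δ^{n-1}(v₀) ⋅ f(v₁ ⊗ … ⊗ v_m)` of the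
Gerstenhaber–Schack differential `d₁`. -/
def termA (m n : ℕ) (f : Pn k N m →ₗ[k] Pn k N n) : Pn k N (m + 1) →ₗ[k] Pn k N n :=
  (MvPolynomial.basisMonomials (Fin (m + 1) × Fin N) k).constr k fun μ =>
    (Δiter k N n) (MvPolynomial.monomial (frontExp N m μ) 1) *
      f (MvPolynomial.monomial (restExp N m μ) 1)

/-- The term `v₀ ⊗ … ⊗ v_m ↦ f(v₀ ⊗ … ⊗ v_{m-1}) ⋅ Δ^{n-1}(v_m)`. -/
def termC (m n : ℕ) (f : Pn k N m →ₗ[k] Pn k N n) : Pn k N (m + 1) →ₗ[k] Pn k N n :=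
  (MvPolynomial.basisMonomials (Fin (m + 1) × Fin N) k).constr k fun μ =>
    f (MvPolynomial.monomial (initExp N m μ) 1) *
      (Δiter k N n) (MvPolynomial.monomial (lastExp N m μ) 1)

/-- The Gerstenhaber–Schack differential `d₁` (Hochschild differential of the algebra `B`
with values in the `B`-bimodule `B^{⊗n}`). -/
def d1 (m n : ℕ) (f : Pn k N m →ₗ[k] Pn k N n) : Pn k N (m + 1) →ₗ[k] Pn k N n :=
  termA k N m n f
    + ∑ i : Fin m, ((-1 : k) ^ ((i : ℕ) + 1)) •
        (f ∘ₗ (MvPolynomial.rename (Prod.map i.predAbove id)).toLinearMap)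
    + ((-1 : k) ^ (m + 1)) • termC k N m n f

/-- The left `B`-comodule structure `λ : B^{⊗m} → B ⊗ B^{⊗m}` (the extra `B`-factor is slot `0`). -/
def lam (m : ℕ) : Pn k N m →ₐ[k] Pn k N (m + 1) :=
  MvPolynomial.aeval fun p =>
    MvPolynomial.X ((0 : Fin (m + 1)), p.2) + MvPolynomial.X (p.1.succ, p.2)

/-- The right `B`-comodule structure `ρ : B^{⊗m} → B^{⊗m} ⊗ B` (the extra `B`-factor is the last slot). -/
def rhoC (m : ℕ) : Pn k N m →ₐ[k] Pn k N (m + 1) :=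
  MvPolynomial.aeval fun p =>
    MvPolynomial.X (p.1.castSucc, p.2) + MvPolynomial.X ((Fin.last m : Fin (m + 1)), p.2)

/-- The map `id_B ⊗ f : B ⊗ B^{⊗m} → B ⊗ B^{⊗n}` (extra factors in slot `0`). -/
def lextend (m n : ℕ) (f : Pn k N m →ₗ[k] Pn k N n) :
    Pn k N (m + 1) →ₗ[k] Pn k N (n + 1) :=
  (MvPolynomial.basisMonomials (Fin (m + 1) × Fin N) k).constr k fun μ =>
    (MvPolynomial.monomial (Finsupp.mapDomain (fun i => ((0 : Fin (n + 1)), i)) (frontExp N m μ))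
        (1 : k)) *
      (MvPolynomial.rename (Prod.map Fin.succ (id : Fin N → Fin N)))
        (f (MvPolynomial.monomial (restExp N m μ) 1))

/-- The map `f ⊗ id_B : B^{⊗m} ⊗ B → B^{⊗n} ⊗ B` (extra factors in the last slot). -/
def rextend (m n : ℕ) (f : Pn k N m →ₗ[k] Pn k N n) :
    Pn k N (m + 1) →ₗ[k] Pn k N (n + 1) :=
  (MvPolynomial.basisMonomials (Fin (m + 1) × Fin N) k).constr k fun μ =>
    (MvPolynomial.rename (Prod.map Fin.castSucc (id : Fin N → Fin N)))
        (f (MvPolynomial.monomial (initExp N m μ) 1)) *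
      (MvPolynomial.monomial
        (Finsupp.mapDomain (fun i => ((Fin.last n : Fin (n + 1)), i)) (lastExp N m μ)) (1 : k))

/-- The map `id^{⊗i} ⊗ Δ ⊗ id^{⊗(n-1-i)} : B^{⊗n} → B^{⊗(n+1)}` splitting slot `i`
into slots `i, i+1`. -/
def coface (n : ℕ) (i : Fin n) : Pn k N n →ₐ[k] Pn k N (n + 1) :=
  MvPolynomial.aeval fun p =>
    if p.1 = i then
      MvPolynomial.X ((i.castSucc : Fin (n + 1)), p.2) + MvPolynomial.X (i.succ, p.2)
    else MvPolynomial.X (i.castSucc.succAbove p.1, p.2)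

/-- The Gerstenhaber–Schack differential `d₂` (dual co-Hochschild differential of the
coalgebra `B` with values in the `B`-bicomodule `B^{⊗m}`). -/
def d2 (m n : ℕ) (f : Pn k N m →ₗ[k] Pn k N n) : Pn k N m →ₗ[k] Pn k N (n + 1) :=
  (lextend k N m n f) ∘ₗ (lam k N m).toLinearMap
    + ∑ i : Fin n, ((-1 : k) ^ ((i : ℕ) + 1)) • ((coface k N n i).toLinearMap ∘ₗ f)
    + ((-1 : k) ^ (n + 1)) • ((rextend k N m n f) ∘ₗ (rhoC k N m).toLinearMap)

/-- The vector space `W` with its standard basis `x¹,…,x^N`. -/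
abbrev W : Type := Fin N → k

/-- Linear embedding of `W` into slot `t` of `B^{⊗n}`: `x^j ↦ x_{(t,j)}`. -/
def slotEmb (n : ℕ) (t : Fin n) : W k N →ₗ[k] Pn k N n :=
  (Pi.basisFun k (Fin N)).constr k fun j => MvPolynomial.X (t, j)

/-- The multilinear map `(w₁,…,w_n) ↦ (w₁ ⊗ … ⊗ w_n)` placing the `t`-th vector into slot `t`. -/
def placeMulti (n : ℕ) : MultilinearMap k (fun _ : Fin n => W k N) (Pn k N n) :=
  (MultilinearMap.mkPiAlgebra k (Fin n) (Pn k N n)).compLinearMap fun t => slotEmb k N n t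

/-- The canonical (antisymmetrization) inclusion `Λ^n W → W^{⊗n} ⊂ B^{⊗n}`,
`w₁∧…∧w_n ↦ Σ_σ sgn(σ) w_{σ(1)} ⊗ … ⊗ w_{σ(n)}`. -/
def altPlace (n : ℕ) : (⋀[k]^n (W k N)) →ₗ[k] Pn k N n :=
  (ExteriorAlgebra.liftAlternating
      (Function.update (fun i => (0 : (W k N) [⋀^Fin i]→ₗ[k] Pn k N n)) n
        (MultilinearMap.alternatization (placeMulti k N n)))) ∘ₗ
    (⋀[k]^n (W k N)).subtype

/-- The wedge `x^{a₁} ∧ … ∧ x^{a_m}` of standard basis vectors, as an element of `Λ^m W`. -/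
def basisWedge (m : ℕ) (a : Fin m → Fin N) : (⋀[k]^m (W k N)) :=
  ⟨ExteriorAlgebra.ιMulti k m fun s => Pi.single (a s) (1 : k),
    ExteriorAlgebra.ιMulti_range k m (Set.mem_range_self _)⟩

/-- The first-order polydifferential operator `F₁(f) ∈ Hom_poly(B^{⊗m}, B^{⊗n})` associated
to `f ∈ Hom_k(Λ^m W, Λ^n W)`:
`F₁(f)(g₁⊗…⊗g_m) = Σ_{a,b} f^{b₁…b_n}_{a₁…a_m} (x^{b₁}⊗…⊗x^{b_n}) ⋅ Δ^{n-1}(∂g₁/∂x^{a₁}) ⋯ Δ^{n-1}(∂g_m/∂x^{a_m})`. -/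
def F1 (m n : ℕ) (f : (⋀[k]^m (W k N)) →ₗ[k] (⋀[k]^n (W k N))) :
    Pn k N m →ₗ[k] Pn k N n :=
  ∑ a : Fin m → Fin N,
    (LinearMap.mulLeft k (altPlace k N n (f (basisWedge k N m a)))) ∘ₗ
      (spread k N m n).toLinearMap ∘ₗ derivOp k N m fun s => [a s]

section

variable {k : Type} [Field k] {N : ℕ}

theorem alternating_telescope {M : Type*} [AddCommGroup M] [Module k M] :
    ∀ (m : ℕ) (T : Fin (m + 1) → M),
      T 0 + ∑ i : Fin m, ((-1 : k) ^ ((i : ℕ) + 1)) • (T i.castSucc + T i.succ)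
        + ((-1 : k) ^ (m + 1)) • T (Fin.last m) = 0
  | 0, T => by simp
  | m + 1, T => by
    have ih := alternating_telescope m fun j => T j.castSucc
    rw [Fin.sum_univ_castSucc]
    simp only [Fin.castSucc_zero, Fin.val_castSucc, Fin.val_last, Fin.succ_last,
      Fin.succ_castSucc] at ih ⊢
    rw [← ih, pow_succ _ (m + 1)]
    module

/-- Linear maps out of a polynomial ring in a disjoint union of two groups of variables, given on
monomials by a bilinear map in the two parts. -/
theorem constr_comapDomain_rename_mul {σ A B M : Type*} [AddCommGroup M] [Module k M]
    (e₀ : A → σ) (e₁ : B → σ) (h₀ : Function.Injective e₀) (h₁ : Function.Injective e₁)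
    (hd : ∀ a b, e₀ a ≠ e₁ b)
    (G : MvPolynomial A k →ₗ[k] MvPolynomial B k →ₗ[k] M) (p : MvPolynomial A k)
    (q : MvPolynomial B k) :
    (MvPolynomial.basisMonomials σ k).constr k
        (fun μ => G (monomial (Finsupp.comapDomain e₀ μ h₀.injOn) 1)
          (monomial (Finsupp.comapDomain e₁ μ h₁.injOn) 1))
        (rename e₀ p * rename e₁ q) = G p q := by
  induction p using MvPolynomial.induction_on' with
  | add p p' hp hp' => simp only [map_add, add_mul, hp, hp', LinearMap.add_apply]
  | monomial u a =>
    induction q using MvPolynomial.induction_on' with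
    | add q q' hq hq' => simp only [map_add, mul_add, hq, hq']
    | monomial v b =>
      have key : rename e₀ (monomial u a) * rename e₁ (monomial v b) =
          (a * b) • MvPolynomial.basisMonomials σ k (u.mapDomain e₀ + v.mapDomain e₁) := by
        rw [rename_monomial, rename_monomial, monomial_mul, coe_basisMonomials, smul_monomial,
          smul_eq_mul, mul_one]
      have hu : Finsupp.comapDomain e₀ (u.mapDomain e₀ + v.mapDomain e₁) h₀.injOn = u := by
        ext x
        simp [Finsupp.mapDomain_apply h₀,
          Finsupp.mapDomain_of_notMem_range v (e₀ x) (by rintro ⟨b, hb⟩; exact hd x b hb.symm)]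
      have hv : Finsupp.comapDomain e₁ (u.mapDomain e₀ + v.mapDomain e₁) h₁.injOn = v := by
        ext x
        simp [Finsupp.mapDomain_apply h₁,
          Finsupp.mapDomain_of_notMem_range u (e₁ x) (by rintro ⟨b, hb⟩; exact hd b x hb)]
      have ha : monomial u a = a • monomial u (1 : k) := by simp [smul_monomial]
      have hb : monomial v b = b • monomial v (1 : k) := by simp [smul_monomial]
      rw [key, map_smul, Module.Basis.constr_basis, hu, hv, ha, hb, map_smul, map_smul,
        LinearMap.smul_apply, smul_smul, mul_comm]

/-- The pure tensor `g₁ ⊗ ⋯ ⊗ g_m` in `B^{⊗m}`. -/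
def pureTensor (m : ℕ) (g : Fin m → MvPolynomial (Fin N) k) : Pn k N m :=
  ∏ s, rename (fun i => (s, i)) (g s)

theorem monomial_eq_pureTensor (m : ℕ) (μ : (Fin m × Fin N) →₀ ℕ) :
    (monomial μ (1 : k)) = pureTensor m fun s => ∏ i, X i ^ μ (s, i) := by
  simp only [pureTensor, map_prod, map_pow, rename_X]
  rw [monomial_eq, Finsupp.prod_fintype _ _ (by simp), Fintype.prod_prod_type]
  simp

theorem linearMap_ext_pureTensor {m : ℕ} {M : Type*} [AddCommGroup M] [Module k M]
    {φ ψ : Pn k N m →ₗ[k] M} (h : ∀ g, φ (pureTensor m g) = ψ (pureTensor m g)) : φ = ψ :=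
  (MvPolynomial.basisMonomials (Fin m × Fin N) k).ext fun μ => by
    simp only [coe_basisMonomials, monomial_eq_pureTensor, h]

theorem pureTensor_succ (m : ℕ) (g : Fin (m + 1) → MvPolynomial (Fin N) k) :
    pureTensor (m + 1) g = rename (fun i => ((0 : Fin (m + 1)), i)) (g 0) *
      rename (fun p : Fin m × Fin N => (p.1.succ, p.2)) (pureTensor m fun s => g s.succ) := by
  simp only [pureTensor, Fin.prod_univ_succ, map_prod, rename_rename, Function.comp_def]

theorem pureTensor_castSucc (m : ℕ) (g : Fin (m + 1) → MvPolynomial (Fin N) k) :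
    pureTensor (m + 1) g = rename (fun i => (Fin.last m, i)) (g (Fin.last m)) *
      rename (fun p : Fin m × Fin N => (p.1.castSucc, p.2))
        (pureTensor m fun s => g s.castSucc) := by
  simp only [pureTensor, Fin.prod_univ_castSucc, map_prod, rename_rename, Function.comp_def]
  rw [mul_comm]

theorem slot_injective {m : ℕ} (s : Fin m) :
    Function.Injective fun i : Fin N => (s, i) :=
  Prod.mk_right_injective s

theorem shift_injective {m n : ℕ} {e : Fin m → Fin n} (he : Function.Injective e) :
    Function.Injective fun p : Fin m × Fin N => (e p.1, p.2) :=
  he.prodMap Function.injective_id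

theorem termA_pureTensor (m n : ℕ) (f : Pn k N m →ₗ[k] Pn k N n)
    (v : Fin (m + 1) → MvPolynomial (Fin N) k) :
    termA k N m n f (pureTensor (m + 1) v) =
      Δiter k N n (v 0) * f (pureTensor m fun s => v s.succ) := by
  rw [pureTensor_succ]
  exact constr_comapDomain_rename_mul _ _ (slot_injective 0)
    (shift_injective (Fin.succ_injective m))
    (fun a b h => (Fin.succ_ne_zero b.1 (congrArg Prod.fst h).symm))
    ((LinearMap.mul k (Pn k N n)).compl₁₂ (Δiter k N n).toLinearMap f) _ _

theorem termC_pureTensor (m n : ℕ) (f : Pn k N m →ₗ[k] Pn k N n)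
    (v : Fin (m + 1) → MvPolynomial (Fin N) k) :
    termC k N m n f (pureTensor (m + 1) v) =
      Δiter k N n (v (Fin.last m)) * f (pureTensor m fun s => v s.castSucc) := by
  rw [pureTensor_castSucc, mul_comm (Δiter k N n _)]
  exact constr_comapDomain_rename_mul _ _ (slot_injective (Fin.last m))
    (shift_injective (Fin.castSucc_injective m))
    (fun a b h => ((Fin.castSucc_lt_last b.1).ne (congrArg Prod.fst h).symm))
    ((LinearMap.mul k (Pn k N n)).flip.compl₁₂ (Δiter k N n).toLinearMap f) _ _

theorem lextend_rename_mul (m n : ℕ) (f : Pn k N m →ₗ[k] Pn k N n)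
    (p : MvPolynomial (Fin N) k) (q : Pn k N m) :
    lextend k N m n f (rename (fun i => ((0 : Fin (m + 1)), i)) p *
        rename (fun p : Fin m × Fin N => (p.1.succ, p.2)) q) =
      rename (fun i => ((0 : Fin (n + 1)), i)) p * rename (Prod.map Fin.succ id) (f q) := by
  refine Eq.trans ?_ (constr_comapDomain_rename_mul _ _ (slot_injective 0)
    (shift_injective (Fin.succ_injective m))
    (fun a b h => (Fin.succ_ne_zero b.1 (congrArg Prod.fst h).symm))
    ((LinearMap.mul k (Pn k N (n + 1))).compl₁₂
      (rename (fun i => ((0 : Fin (n + 1)), i))).toLinearMap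
      ((rename (Prod.map Fin.succ id)).toLinearMap ∘ₗ f)) p q)
  simp only [LinearMap.compl₁₂_apply, AlgHom.toLinearMap_apply, rename_monomial]
  rfl

theorem rextend_rename_mul (m n : ℕ) (f : Pn k N m →ₗ[k] Pn k N n)
    (p : MvPolynomial (Fin N) k) (q : Pn k N m) :
    rextend k N m n f (rename (fun i => (Fin.last m, i)) p *
        rename (fun p : Fin m × Fin N => (p.1.castSucc, p.2)) q) =
      rename (fun i => (Fin.last n, i)) p * rename (Prod.map Fin.castSucc id) (f q) := by
  refine Eq.trans ?_ (constr_comapDomain_rename_mul _ _ (slot_injective (Fin.last m))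
    (shift_injective (Fin.castSucc_injective m))
    (fun a b h => ((Fin.castSucc_lt_last b.1).ne (congrArg Prod.fst h).symm))
    ((LinearMap.mul k (Pn k N (n + 1))).compl₁₂
      (rename (fun i => (Fin.last n, i))).toLinearMap
      ((rename (Prod.map Fin.castSucc id)).toLinearMap ∘ₗ f)) p q)
  simp only [LinearMap.compl₁₂_apply, AlgHom.toLinearMap_apply, rename_monomial]
  simp only [LinearMap.mul_apply', mul_comm (monomial _ _)]
  rfl

/-- The composite of the partial derivatives along a list of variables. -/
def iterPderiv {σ : Type*} (l : List σ) : MvPolynomial σ k →ₗ[k] MvPolynomial σ k :=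
  l.foldr (fun p g => (pderiv p).toLinearMap.comp g) LinearMap.id

theorem iterPderiv_cons {σ : Type*} (x : σ) (l : List σ) (p : MvPolynomial σ k) :
    iterPderiv (x :: l) p = pderiv x (iterPderiv l p) := rfl

theorem iterPderiv_map {σ τ : Type*} (e : σ → τ) (φ : MvPolynomial σ k →ₐ[k] MvPolynomial τ k)
    (h : ∀ x p, pderiv (e x) (φ p) = φ (pderiv x p)) (l : List σ) (p : MvPolynomial σ k) :
    iterPderiv (l.map e) (φ p) = φ (iterPderiv l p) := by
  induction l with
  | nil => rfl
  | cons x l ih => rw [List.map_cons, iterPderiv_cons, iterPderiv_cons, ih, h]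

theorem iterPderiv_mul_of_pderiv_eq_zero {σ : Type*} (l : List σ) (c p : MvPolynomial σ k)
    (h : ∀ x ∈ l, pderiv x c = 0) : iterPderiv l (c * p) = c * iterPderiv l p := by
  induction l with
  | nil => rfl
  | cons x l ih =>
    rw [iterPderiv_cons, iterPderiv_cons, ih fun y hy => h y (List.mem_cons_of_mem x hy),
      Derivation.leibniz, h x List.mem_cons_self, smul_zero, add_zero, smul_eq_mul]

theorem pderiv_rename_eq_zero {σ τ : Type*} (e : σ → τ) (y : τ) (hy : ∀ x, e x ≠ y)
    (p : MvPolynomial σ k) : pderiv y (rename e p) = 0 := by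
  classical
  refine pderiv_eq_zero_of_notMem_vars fun hmem => ?_
  obtain ⟨x, -, hx⟩ := Finset.mem_image.mp (vars_rename e p hmem)
  exact hy x hx

theorem derivOp_singleton (m : ℕ) (a : Fin m → Fin N) :
    derivOp k N m (fun s => [a s]) = iterPderiv ((List.finRange m).map fun s => (s, a s)) := by
  simp only [derivOp, iterPderiv, List.map_cons, List.map_nil]
  rw [← List.flatMap_pure_eq_map]
  rfl

theorem pderiv_pureTensor (m : ℕ) (s : Fin m) (i : Fin N)
    (g : Fin m → MvPolynomial (Fin N) k) :
    pderiv (s, i) (pureTensor m g) =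
      pureTensor m (Function.update g s (pderiv i (g s))) := by
  have hz : pderiv (s, i) (∏ t ∈ Finset.univ.erase s, rename (fun i => (t, i)) (g t)) = 0 := by
    refine Finset.prod_induction _ (fun p => pderiv (s, i) p = 0) ?_ (by simp) ?_
    · intro p q hp hq
      rw [Derivation.leibniz, hp, hq, smul_zero, smul_zero, add_zero]
    · intro t ht
      exact pderiv_rename_eq_zero _ _
        (fun x h => (Finset.ne_of_mem_erase ht) (congrArg Prod.fst h)) _
  rw [pureTensor, pureTensor, ← Finset.mul_prod_erase _ _ (Finset.mem_univ s),
    ← Finset.mul_prod_erase _ _ (Finset.mem_univ s), Derivation.leibniz, hz, smul_zero, zero_add,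
    pderiv_rename (slot_injective s), Function.update_self, smul_eq_mul, mul_comm]
  congr 1
  refine Finset.prod_congr rfl fun t ht => ?_
  rw [Function.update_of_ne (Finset.ne_of_mem_erase ht)]

theorem derivOp_pureTensor (m : ℕ) (a : Fin m → Fin N)
    (g : Fin m → MvPolynomial (Fin N) k) :
    derivOp k N m (fun s => [a s]) (pureTensor m g) =
      pureTensor m fun s => pderiv (a s) (g s) := by
  have key : ∀ l : List (Fin m), l.Nodup →
      iterPderiv (l.map fun s => (s, a s)) (pureTensor m g) =
        pureTensor m fun s => if s ∈ l then pderiv (a s) (g s) else g s := by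
    intro l
    induction l with
    | nil => intro _; simp [iterPderiv]
    | cons x l ih =>
      intro hl
      obtain ⟨hx, hl⟩ := List.nodup_cons.mp hl
      rw [List.map_cons, iterPderiv_cons, ih hl, pderiv_pureTensor]
      congr 1
      funext s
      by_cases hs : s = x
      · subst hs; simp [hx]
      · simp [hs]
  rw [derivOp_singleton, key _ (List.nodup_finRange m)]
  simp

theorem spread_pureTensor (m n : ℕ) (g : Fin m → MvPolynomial (Fin N) k) :
    spread k N m n (pureTensor m g) = ∏ s, Δiter k N n (g s) := by
  simp only [pureTensor, map_prod, spread, Δiter, aeval_rename, Function.comp_def]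

theorem F1_pureTensor (m n : ℕ) (f : (⋀[k]^m (W k N)) →ₗ[k] (⋀[k]^n (W k N)))
    (g : Fin m → MvPolynomial (Fin N) k) :
    F1 k N m n f (pureTensor m g) =
      ∑ a : Fin m → Fin N, altPlace k N n (f (basisWedge k N m a)) *
        ∏ s, Δiter k N n (pderiv (a s) (g s)) := by
  simp only [F1, LinearMap.sum_apply, LinearMap.comp_apply, LinearMap.mulLeft_apply,
    AlgHom.toLinearMap_apply, derivOp_pureTensor, spread_pureTensor]

theorem succ_succAbove_eq_castSucc_succAbove {m : ℕ} {i s : Fin m} (h : s ≠ i) :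
    i.succ.succAbove s = i.castSucc.succAbove s := by
  rcases lt_or_gt_of_ne h with h | h
  · rw [Fin.succAbove_of_castSucc_lt _ _ (by simpa [Fin.lt_def] using Nat.lt_succ_of_lt h),
      Fin.succAbove_of_castSucc_lt _ _ (by simpa using h)]
  · rw [Fin.succAbove_of_le_castSucc _ _ (by simpa [Fin.le_def] using h),
      Fin.succAbove_of_le_castSucc _ _ (by simpa using h.le)]

theorem rename_predAbove_pureTensor (m : ℕ) (i : Fin m)
    (v : Fin (m + 1) → MvPolynomial (Fin N) k) :
    rename (Prod.map i.predAbove id) (pureTensor (m + 1) v) =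
      pureTensor m (Function.update (fun s => v (i.castSucc.succAbove s)) i
        (v i.castSucc * v i.succ)) := by
  simp only [pureTensor, map_prod, rename_rename, Function.comp_def, Prod.map_apply, id_eq]
  have hsplit (φ : Fin m → Pn k N m) := (Finset.mul_prod_erase _ φ (Finset.mem_univ i)).symm
  have hmerge : ∏ s ∈ Finset.univ.erase i, rename (fun j => (s, j))
        (Function.update (fun s => v (i.castSucc.succAbove s)) i (v i.castSucc * v i.succ) s) =
      ∏ s ∈ Finset.univ.erase i, rename (fun j => (s, j)) (v (i.castSucc.succAbove s)) :=
    Finset.prod_congr rfl fun t ht => by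
      rw [Function.update_of_ne (Finset.ne_of_mem_erase ht)]
  rw [Fin.prod_univ_succAbove _ i.castSucc]
  simp only [hsplit, Function.update_self, hmerge, Fin.predAbove_castSucc_self,
    Fin.predAbove_succAbove, Fin.succAbove_castSucc_self, map_mul, mul_assoc]

theorem d1_F1 (m n : ℕ) (f : (⋀[k]^m (W k N)) →ₗ[k] (⋀[k]^n (W k N))) :
    d1 k N m n (F1 k N m n f) = 0 := by
  refine linearMap_ext_pureTensor fun v => ?_
  have hface : ∀ i : Fin m,
      F1 k N m n f (rename (Prod.map i.predAbove id) (pureTensor (m + 1) v)) =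
        Δiter k N n (v i.castSucc) *
            F1 k N m n f (pureTensor m fun s => v (i.castSucc.succAbove s)) +
          Δiter k N n (v i.succ) *
            F1 k N m n f (pureTensor m fun s => v (i.succ.succAbove s)) := by
    intro i
    simp only [rename_predAbove_pureTensor, F1_pureTensor, Finset.mul_sum]
    rw [← Finset.sum_add_distrib]
    refine Finset.sum_congr rfl fun a _ => ?_
    have hsplit (φ : Fin m → Pn k N n) := (Finset.mul_prod_erase _ φ (Finset.mem_univ i)).symm
    simp only [hsplit, Function.update_self,
      Fin.succAbove_castSucc_self, Fin.succAbove_succ_self, Derivation.leibniz, map_add,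
      smul_eq_mul, map_mul]
    have hmerge : ∏ s ∈ Finset.univ.erase i, Δiter k N n (pderiv (a s)
          (Function.update (fun s => v (i.castSucc.succAbove s)) i (v i.castSucc * v i.succ) s)) =
        ∏ s ∈ Finset.univ.erase i, Δiter k N n (pderiv (a s) (v (i.castSucc.succAbove s))) :=
      Finset.prod_congr rfl fun t ht => by
        rw [Function.update_of_ne (Finset.ne_of_mem_erase ht)]
    have hskip : ∏ s ∈ Finset.univ.erase i, Δiter k N n (pderiv (a s) (v (i.succ.succAbove s))) =
        ∏ s ∈ Finset.univ.erase i, Δiter k N n (pderiv (a s) (v (i.castSucc.succAbove s))) :=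
      Finset.prod_congr rfl fun t ht => by
        rw [succ_succAbove_eq_castSucc_succAbove (Finset.ne_of_mem_erase ht)]
    rw [hmerge, hskip]
    ring
  have := alternating_telescope (k := k) m fun j =>
    Δiter k N n (v j) * F1 k N m n f (pureTensor m fun s => v (j.succAbove s))
  simp only [d1, LinearMap.add_apply, LinearMap.sum_apply, LinearMap.smul_apply,
    LinearMap.comp_apply, AlgHom.toLinearMap_apply, termA_pureTensor, termC_pureTensor, hface,
    LinearMap.zero_apply]
  simpa only [Fin.succAbove_zero, Fin.succAbove_last] using this

/-- The span of the elements `x^{b₁} ⊗ ⋯ ⊗ x^{b_n}`, i.e. `W^{⊗n} ⊆ B^{⊗n}`. -/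
def multilinearPart (n : ℕ) : Submodule k (Pn k N n) :=
  Submodule.span k (Set.range fun b : Fin n → Fin N => ∏ t, X (t, b t))

theorem placeMulti_mem_multilinearPart (n : ℕ) (w : Fin n → W k N) :
    placeMulti k N n w ∈ multilinearPart n := by
  have : placeMulti k N n w = ∏ t, ∑ j, w t j • (X (t, j) : Pn k N n) := by
    simp [placeMulti, slotEmb, Module.Basis.constr_apply_fintype]
  rw [this, Finset.prod_univ_sum]
  refine Submodule.sum_mem _ fun b _ => ?_
  rw [Finset.prod_smul]
  exact Submodule.smul_mem _ _ (Submodule.subset_span ⟨b, rfl⟩)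

theorem altPlace_mem_multilinearPart (n : ℕ) (x : ⋀[k]^n (W k N)) :
    altPlace k N n x ∈ multilinearPart n := by
  obtain ⟨x, hx⟩ := x
  change ExteriorAlgebra.liftAlternating _ x ∈ _
  replace hx := (ExteriorAlgebra.ιMulti_span_fixedDegree k n (M := W k N)).symm ▸ hx
  induction hx using Submodule.span_induction with
  | zero => rw [map_zero]; exact Submodule.zero_mem _
  | add x y _ _ hx hy => rw [map_add]; exact Submodule.add_mem _ hx hy
  | smul c x _ hx => rw [map_smul]; exact Submodule.smul_mem _ _ hx
  | mem x hx =>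
    obtain ⟨w, rfl⟩ := hx
    rw [ExteriorAlgebra.liftAlternating_apply_ιMulti, Function.update_self,
      MultilinearMap.alternatization_apply]
    exact Submodule.sum_mem _ fun σ _ =>
      (multilinearPart n).toAddSubgroup.zsmul_mem (placeMulti_mem_multilinearPart n _) _

theorem F1_mem_polyHom (m n : ℕ) (f : (⋀[k]^m (W k N)) →ₗ[k] (⋀[k]^n (W k N))) :
    F1 k N m n f ∈ polyHom k N m n := by
  refine Submodule.sum_mem _ fun a _ => ?_
  have hP := altPlace_mem_multilinearPart n (f (basisWedge k N m a))
  generalize altPlace k N n (f (basisWedge k N m a)) = P at hP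
  change (LinearMap.mul k (Pn k N n)) P ∘ₗ _ ∈ _
  induction hP using Submodule.span_induction with
  | zero => rw [map_zero, LinearMap.zero_comp]; exact Submodule.zero_mem _
  | add x y _ _ hx hy => rw [map_add, LinearMap.add_comp]; exact Submodule.add_mem _ hx hy
  | smul c x _ hx => rw [map_smul, LinearMap.smul_comp]; exact Submodule.smul_mem _ _ hx
  | mem x hx =>
    obtain ⟨b, rfl⟩ := hx
    refine Submodule.subset_span ⟨fun s => [a s], fun t => [b t], ?_⟩
    simp only [Γop, xMon, List.map_cons, List.map_nil, List.prod_singleton]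
    rfl

theorem coface_prod_X (n : ℕ) (i : Fin n) (b : Fin n → Fin N) :
    coface k N n i (∏ t, X (t, b t)) =
      ∏ t, X (i.castSucc.succAbove t, b t) + ∏ t, X (i.succ.succAbove t, b t) := by
  simp only [coface, map_prod, aeval_X]
  simp only [← Finset.mul_prod_erase _ _ (Finset.mem_univ i), Fin.succAbove_castSucc_self,
    Fin.succAbove_succ_self, if_true]
  rw [Finset.prod_congr rfl fun t ht => if_neg (Finset.ne_of_mem_erase ht),
    Finset.prod_congr (g := fun t => (X (i.castSucc.succAbove t, b t) : Pn k N (n + 1)))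
      (f := fun t => X (i.succ.succAbove t, b t)) (s₁ := Finset.univ.erase i) rfl fun t ht => by
      rw [succ_succAbove_eq_castSucc_succAbove (Finset.ne_of_mem_erase ht)]]
  ring

theorem coface_telescope (n : ℕ) {P : Pn k N n} (hP : P ∈ multilinearPart n) :
    rename (Prod.map Fin.succ id) P
      + ∑ i : Fin n, ((-1 : k) ^ ((i : ℕ) + 1)) • coface k N n i P
      + ((-1 : k) ^ (n + 1)) • rename (Prod.map Fin.castSucc id) P = 0 := by
  let L : Pn k N n →ₗ[k] Pn k N (n + 1) :=
    (rename (Prod.map Fin.succ id)).toLinearMap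
      + ∑ i : Fin n, ((-1 : k) ^ ((i : ℕ) + 1)) • (coface k N n i).toLinearMap
      + ((-1 : k) ^ (n + 1)) • (rename (Prod.map Fin.castSucc id)).toLinearMap
  have hL : multilinearPart n ≤ LinearMap.ker L := by
    refine Submodule.span_le.mpr ?_
    rintro _ ⟨b, rfl⟩
    have := alternating_telescope (k := k) n fun j =>
      (∏ t, X (j.succAbove t, b t) : Pn k N (n + 1))
    simp only [L, SetLike.mem_coe, LinearMap.mem_ker, LinearMap.add_apply, LinearMap.sum_apply,
      LinearMap.smul_apply, AlgHom.toLinearMap_apply, coface_prod_X]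
    simpa only [map_prod, rename_X, Prod.map_apply, id_eq, Fin.succAbove_zero,
      Fin.succAbove_last] using this
  simpa [L] using hL hP

theorem coface_spread (m n : ℕ) (i : Fin n) (p : Pn k N m) :
    coface k N n i (spread k N m n p) = spread k N m (n + 1) p := by
  revert p
  refine AlgHom.congr_fun (φ₁ := (coface k N n i).comp (spread k N m n)) ?_
  refine MvPolynomial.algHom_ext fun x => ?_
  simp only [AlgHom.comp_apply, spread, coface, aeval_X, map_sum]
  rw [Fin.sum_univ_succAbove _ i.castSucc, ← Finset.add_sum_erase _ _ (Finset.mem_univ i),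
    ← Finset.add_sum_erase _ _ (Finset.mem_univ i), if_pos rfl, Fin.succAbove_castSucc_self,
    add_assoc, Finset.sum_congr rfl fun t ht => if_neg (Finset.ne_of_mem_erase ht)]

/-- If `E` is the extension of `∑ j, P j · Δ^{n-1} ∘ ∂^{a j}` by the identity on a distinguished slot
(`c` in the source, `c'` in the target) and `eb` is the coaction of `B` landing in slot `c`, then
`E ∘ eb` has the same form, with `Δⁿ` in place of `Δ^{n-1}` and `P j` inserted off slot `c'`. -/
theorem extend_comp_coaction (m n : ℕ) (c : Fin (m + 1)) (c' : Fin (n + 1))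
    (eb : Pn k N m →ₐ[k] Pn k N (m + 1))
    (heb : ∀ p, eb (X p) = X (c, p.2) + X (c.succAbove p.1, p.2))
    (E : Pn k N (m + 1) →ₗ[k] Pn k N (n + 1)) {ι : Type*} [Fintype ι]
    (P : ι → Pn k N n) (a : ι → Fin m → Fin N)
    (hE : ∀ (p : MvPolynomial (Fin N) k) (q : Pn k N m),
      E (rename (fun i => (c, i)) p *
        rename (fun p : Fin m × Fin N => (c.succAbove p.1, p.2)) q) =
      rename (fun i => (c', i)) p * rename (Prod.map c'.succAbove id)
        (∑ j, P j * spread k N m n (derivOp k N m (fun s => [a j s]) q)))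
    (g : Pn k N m) :
    E (eb g) = ∑ j, rename (Prod.map c'.succAbove id) (P j) *
      spread k N m (n + 1) (derivOp k N m (fun s => [a j s]) g) := by
  let sh : Fin m × Fin N → Fin (m + 1) × Fin N := fun p => (c.succAbove p.1, p.2)
  let S : Pn k N (m + 1) →ₐ[k] Pn k N (n + 1) := aeval fun p =>
    if p.1 = c then X (c', p.2) else ∑ t : Fin n, X (c'.succAbove t, p.2)
  let D (j : ι) : Pn k N (m + 1) →ₗ[k] Pn k N (m + 1) :=
    iterPderiv (((List.finRange m).map fun s => (s, a j s)).map sh)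
  have hS₀ (p : MvPolynomial (Fin N) k) :
      S (rename (fun i => (c, i)) p) = rename (fun i => (c', i)) p := by
    simp only [S, aeval_rename, Function.comp_def, if_true]
    rw [← Function.comp_def X, ← rename_eq_aeval]
  have hS₁ (q : Pn k N m) :
      S (rename sh q) = rename (Prod.map c'.succAbove id) (spread k N m n q) := by
    revert q
    refine AlgHom.congr_fun (φ₁ := S.comp (rename sh))
      (φ₂ := (rename (Prod.map c'.succAbove id)).comp (spread k N m n)) ?_
    refine MvPolynomial.algHom_ext fun x => ?_
    simp [S, sh, spread, Fin.succAbove_ne]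
  have hS₂ (q : Pn k N m) : S (eb q) = spread k N m (n + 1) q := by
    revert q
    refine AlgHom.congr_fun (φ₁ := S.comp eb) ?_
    refine MvPolynomial.algHom_ext fun x => ?_
    simp [S, heb, spread, Fin.succAbove_ne, Fin.sum_univ_succAbove _ c']
  have hD (x : Fin m × Fin N) (p : Pn k N m) : pderiv (sh x) (eb p) = eb (pderiv x p) := by
    induction p using MvPolynomial.induction_on with
    | C r => simp [← algebraMap_eq]
    | add p q hp hq => simp only [map_add, hp, hq]
    | mul_X p y hp =>
      have h₀ : (pderiv (sh x) (X (c, y.2) : Pn k N (m + 1))) = 0 :=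
        pderiv_X_of_ne fun h => Fin.succAbove_ne c x.1 (congrArg Prod.fst h).symm
      have h₁ : pderiv (sh x) (X (sh y) : Pn k N (m + 1)) = eb (pderiv x (X y)) := by
        classical
        simp only [pderiv_X]
        by_cases hxy : y = x
        · subst hxy; simp
        · have : sh y ≠ sh x := fun h => hxy (shift_injective Fin.succAbove_right_injective h)
          simp [Ne.symm hxy, this.symm]
      simp only [Derivation.leibniz, smul_eq_mul, map_add, map_mul, hp, heb, h₀, zero_add]
      rw [← h₁]
  have hmain : E = ∑ j, LinearMap.mulLeft k (rename (Prod.map c'.succAbove id) (P j)) ∘ₗ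
      S.toLinearMap ∘ₗ D j := by
    refine linearMap_ext_pureTensor fun v => ?_
    have hv : pureTensor (m + 1) v = rename (fun i => (c, i)) (v c) *
        rename sh (pureTensor m fun s => v (c.succAbove s)) := by
      simp only [pureTensor, Fin.prod_univ_succAbove _ c, map_prod, rename_rename,
        Function.comp_def, sh]
    rw [hv, hE]
    simp only [LinearMap.sum_apply, LinearMap.comp_apply, LinearMap.mulLeft_apply,
      AlgHom.toLinearMap_apply, map_sum, Finset.mul_sum, map_mul]
    refine Finset.sum_congr rfl fun j _ => ?_
    rw [iterPderiv_mul_of_pderiv_eq_zero, iterPderiv_map sh (rename sh), map_mul, hS₀, hS₁,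
      derivOp_singleton]
    · ring
    · exact fun x p => pderiv_rename (shift_injective Fin.succAbove_right_injective) _ _
    · intro x hx
      obtain ⟨y, -, rfl⟩ := List.mem_map.mp hx
      exact pderiv_rename_eq_zero _ _
        (fun i h => Fin.succAbove_ne c y.1 (congrArg Prod.fst h).symm) _
  rw [hmain]
  simp only [LinearMap.sum_apply, LinearMap.comp_apply, LinearMap.mulLeft_apply,
    AlgHom.toLinearMap_apply, D, iterPderiv_map sh eb hD, hS₂, derivOp_singleton]

theorem F1_apply (m n : ℕ) (f : (⋀[k]^m (W k N)) →ₗ[k] (⋀[k]^n (W k N))) (g : Pn k N m) :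
    F1 k N m n f g = ∑ a : Fin m → Fin N, altPlace k N n (f (basisWedge k N m a)) *
      spread k N m n (derivOp k N m (fun s => [a s]) g) := by
  simp only [F1, LinearMap.sum_apply, LinearMap.comp_apply, LinearMap.mulLeft_apply,
    AlgHom.toLinearMap_apply]

theorem d2_F1 (m n : ℕ) (f : (⋀[k]^m (W k N)) →ₗ[k] (⋀[k]^n (W k N))) :
    d2 k N m n (F1 k N m n f) = 0 := by
  refine LinearMap.ext fun g => ?_
  have hl := extend_comp_coaction m n 0 0 (lam k N m) (fun p => by simp [lam])
    (lextend k N m n (F1 k N m n f)) (fun a => altPlace k N n (f (basisWedge k N m a)))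
    (fun a => a) (fun p q => by
      simpa only [Fin.succAbove_zero, F1_apply] using lextend_rename_mul m n (F1 k N m n f) p q) g
  have hr := extend_comp_coaction m n (Fin.last m) (Fin.last n) (rhoC k N m)
    (fun p => by simp [rhoC, add_comm])
    (rextend k N m n (F1 k N m n f)) (fun a => altPlace k N n (f (basisWedge k N m a)))
    (fun a => a) (fun p q => by
      simpa only [Fin.succAbove_last, F1_apply] using rextend_rename_mul m n (F1 k N m n f) p q) g
  simp only [d2, LinearMap.add_apply, LinearMap.sum_apply, LinearMap.smul_apply,
    LinearMap.comp_apply, AlgHom.toLinearMap_apply, LinearMap.zero_apply, hl, hr]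
  simp only [F1_apply, map_sum, map_mul, coface_spread, Fin.succAbove_zero, Fin.succAbove_last,
    Finset.smul_sum]
  rw [Finset.sum_comm, ← Finset.sum_add_distrib, ← Finset.sum_add_distrib]
  refine Finset.sum_eq_zero fun a _ => ?_
  simp only [← smul_mul_assoc]
  rw [← Finset.sum_mul, ← add_mul, ← add_mul,
    coface_telescope n (altPlace_mem_multilinearPart n _), zero_mul]

end

/-- the claim `d_gs ∘ F₁ = 0` from the proof of Theorem 1.2 of the paper.
For every `f ∈ Hom_k(Λ^m W, Λ^n W)` the first-order polydifferential operator `F₁(f)` is a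
polydifferential operator satisfying `d₁(F₁(f)) = 0` and `d₂(F₁(f)) = 0`, i.e. `F₁` maps
`Hom_k(Λ^m W, Λ^n W)` into `d_gs`-cocycles of the polydifferential Gerstenhaber–Schack
complex of `B`. -/
theorem F1_cocycle (m n : ℕ) (hm : 1 ≤ m) (hn : 1 ≤ n)
    (f : (⋀[k]^m (W k N)) →ₗ[k] (⋀[k]^n (W k N))) :
    F1 k N m n f ∈ polyHom k N m n ∧
      d1 k N m n (F1 k N m n f) = 0 ∧ d2 k N m n (F1 k N m n f) = 0 :=
  ⟨F1_mem_polyHom m n f, d1_F1 m n f, d2_F1 m n f⟩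

end GS
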